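/- arXiv:1511.08239 — 3 statements merged into one kernel-verified Lean document; each statement's English description precedes it below -/
import Mathlib

section
/- Let n, k ≥ 3 be natural numbers with n ≠ k and let θ be any substitution (monoid endomorphism of A*). If θ(wₙ) is a factor of w_k, then θ(wₙ) = θ(wₙ'); likewise, if θ(wₙ') is a factor of w_k, then θ(wₙ) = θ(wₙ'). -/
abbrev Word : Type := FreeMonoid ℕ

/-- The fixed pairwise distinct variables: `y = 0`, `z = 1`, and `xᵢ = i + 2`. -/
def xv (i : ℕ) : ℕ := i + 2

/-- `wₙ = x₀·yz·x₁x₀·x₂x₁·x₃x₂⋯xₙxₙ₋₁·yz·xₙ`. -/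
def wn (n : ℕ) : Word :=
  FreeMonoid.ofList [xv 0, 0, 1] *
    ((List.range n).map (fun i => FreeMonoid.ofList [xv (i + 1), xv i])).prod *
    FreeMonoid.ofList [0, 1, xv n]

/-- `wₙ' = x₀·zy·x₁x₀·x₂x₁·x₃x₂⋯xₙxₙ₋₁·zy·xₙ`. -/
def wn' (n : ℕ) : Word :=
  FreeMonoid.ofList [xv 0, 1, 0] *
    ((List.range n).map (fun i => FreeMonoid.ofList [xv (i + 1), xv i])).prod *
    FreeMonoid.ofList [1, 0, xv n]

/-- `u` is a factor of `v`. -/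
def IsFactor (u v : Word) : Prop := ∃ a b : Word, v = a * u * b

/-- The list of letters of `x_{i+1}x_i · x_{i+2}x_{i+1} ⋯ x_{i+m}x_{i+m-1}`. -/
def stair : ℕ → ℕ → List ℕ
  | _, 0 => []
  | i, m + 1 => (i + 3) :: (i + 2) :: stair (i + 1) m

lemma stair_succ_right (i m : ℕ) :
    stair i (m + 1) = stair i m ++ [i + m + 3, i + m + 2] := by
  induction m generalizing i with
  | zero => simp [stair]
  | succ m ih =>
    rw [stair, ih (i + 1)]
    simp [stair]
    omega

lemma length_stair (i m : ℕ) : (stair i m).length = 2 * m := by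
  induction m generalizing i with
  | zero => simp [stair]
  | succ m ih => simp [stair, ih]; omega

lemma le_of_mem_stair {i m a : ℕ} (h : a ∈ stair i m) : i + 2 ≤ a := by
  induction m generalizing i with
  | zero => simp [stair] at h
  | succ m ih =>
    simp only [stair, List.mem_cons] at h
    rcases h with h | h | h
    · omega
    · omega
    · have := ih h
      omega

lemma getElem?_stair (i m t : ℕ) (ht : t < 2 * m) :
    (stair i m)[t]? = some (if t % 2 = 0 then i + 3 + t / 2 else i + 2 + t / 2) := by
  induction m generalizing i t with
  | zero => omega
  | succ m ih =>
    match t with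
    | 0 => simp [stair]
    | 1 => simp [stair]
    | t + 2 =>
      simp only [stair, List.getElem?_cons_succ]
      rw [ih (i + 1) t (by omega)]
      congr 1
      split_ifs <;> omega

lemma toList_prod_blocks (n : ℕ) :
    (((List.range n).map (fun i => FreeMonoid.ofList [xv (i + 1), xv i])).prod).toList =
      stair 0 n := by
  induction n with
  | zero => rfl
  | succ n ih =>
    rw [List.range_succ, List.map_append, List.prod_append, FreeMonoid.toList_mul, ih,
      stair_succ_right]
    simp [xv]

lemma toList_wn (n : ℕ) : (wn n).toList = [2, 0, 1] ++ stair 0 n ++ [0, 1, n + 2] := by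
  rw [wn, FreeMonoid.toList_mul, FreeMonoid.toList_mul, toList_prod_blocks]
  simp [xv]

lemma toList_wn' (n : ℕ) : (wn' n).toList = [2, 1, 0] ++ stair 0 n ++ [1, 0, n + 2] := by
  rw [wn', FreeMonoid.toList_mul, FreeMonoid.toList_mul, toList_prod_blocks]
  simp [xv]

lemma toList_map_eq_flatMap (θ : Word →* Word) (w : Word) :
    (θ w).toList = w.toList.flatMap (fun a => (θ (FreeMonoid.of a)).toList) := by
  induction w using FreeMonoid.recOn with
  | one => simp
  | of_mul a w ih => simp [FreeMonoid.toList_mul, ih]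

/-- The letter of `w_k` at position `t`. -/
def letter (k t : ℕ) : ℕ :=
  if t = 0 then 2 else if t = 1 then 0 else if t = 2 then 1
  else if t < 2 * k + 3 then (if t % 2 = 1 then 3 + (t - 3) / 2 else 2 + (t - 3) / 2)
  else if t = 2 * k + 3 then 0 else if t = 2 * k + 4 then 1 else k + 2

lemma letter_cases (k t : ℕ) :
    (t = 0 ∧ letter k t = 2) ∨ (t = 1 ∧ letter k t = 0) ∨ (t = 2 ∧ letter k t = 1) ∨
    (t = 2 * k + 3 ∧ letter k t = 0) ∨ (t = 2 * k + 4 ∧ letter k t = 1) ∨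
    (2 * k + 5 ≤ t ∧ letter k t = k + 2) ∨
    (3 ≤ t ∧ t < 2 * k + 3 ∧ 2 * letter k t = t + 3) ∨
    (4 ≤ t ∧ t < 2 * k + 3 ∧ 2 * letter k t = t) := by
  unfold letter
  split_ifs <;> omega

lemma getElem?_wn (k t : ℕ) (ht : t < 2 * k + 6) :
    ([2, 0, 1] ++ stair 0 k ++ [0, 1, k + 2])[t]? = some (letter k t) := by
  match t with
  | 0 => simp [letter]
  | 1 => simp [letter]
  | 2 => simp [letter]
  | t + 3 =>
    simp only [List.cons_append, List.nil_append, List.getElem?_cons_succ]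
    by_cases h : t < 2 * k
    · rw [List.getElem?_append_left (by rw [length_stair]; exact h), getElem?_stair _ _ _ h,
        Option.some_inj]
      unfold letter
      split_ifs <;> first | contradiction | omega
    · rw [List.getElem?_append_right (by rw [length_stair]; omega), length_stair]
      obtain h | h | h : t = 2 * k ∨ t = 2 * k + 1 ∨ t = 2 * k + 2 := by omega
      all_goals subst h; simp [letter]

/-- The only pair of consecutive letters with two disjoint occurrences in `w_k` is `yz`. -/
lemma eq_of_letter_eq {k i j : ℕ} (hk : 2 ≤ k) (hij : i + 2 ≤ j) (hj : j + 1 < 2 * k + 6)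
    (h₀ : letter k i = letter k j) (h₁ : letter k (i + 1) = letter k (j + 1)) :
    i = 1 ∧ j = 2 * k + 3 := by
  have hi := letter_cases k i
  have hi' := letter_cases k (i + 1)
  have hj := letter_cases k j
  have hj' := letter_cases k (j + 1)
  generalize letter k i = a at *
  generalize letter k (i + 1) = b at *
  generalize letter k j = c at *
  generalize letter k (j + 1) = d at *
  subst h₀ h₁
  rcases hi with hi | hi | hi | hi | hi | hi | hi | hi <;>
    rcases hj with hj | hj | hj | hj | hj | hj | hj | hj <;> omega

/-- A factor of length at least two with two disjoint occurrences in `w_k` occurs exactly at the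
two blocks `yz`. -/
lemma eq_of_repeated_factor {k : ℕ} (hk : 2 ≤ k) {p Y m s : List ℕ} (hY : 2 ≤ Y.length)
    (h : [2, 0, 1] ++ stair 0 k ++ [0, 1, k + 2] = p ++ Y ++ m ++ Y ++ s) :
    p = [2] ∧ m = stair 0 k ∧ s = [k + 2] := by
  have hlen := congrArg List.length h
  simp only [List.length_append, List.length_cons, List.length_nil, length_stair] at hlen
  have key : ∀ r < Y.length,
      letter k (p.length + r) = letter k (p.length + Y.length + m.length + r) := by
    intro r hr
    have e₁ := getElem?_wn k (p.length + r) (by omega)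
    have e₂ := getElem?_wn k (p.length + Y.length + m.length + r) (by omega)
    rw [h] at e₁ e₂
    have f₁ : (p ++ Y ++ m ++ Y ++ s)[p.length + r]? = Y[r]? := by
      simp only [List.append_assoc]
      rw [List.getElem?_append_right (by omega), Nat.add_sub_cancel_left,
        List.getElem?_append_left hr]
    have f₂ : (p ++ Y ++ m ++ Y ++ s)[p.length + Y.length + m.length + r]? = Y[r]? := by
      rw [List.getElem?_append_left (by simp; omega),
        List.getElem?_append_right (by simp; omega)]
      congr 1
      simp
      omega
    rw [f₁] at e₁
    rw [f₂, e₁] at e₂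
    exact Option.some.inj e₂
  obtain ⟨hp, hj⟩ := eq_of_letter_eq hk (i := p.length) (j := p.length + Y.length + m.length)
    (by omega) (by omega) (key 0 (by omega)) (key 1 (by omega))
  have hY2 : Y.length = 2 := by
    by_contra hne
    have h₂ := key 2 (by omega)
    rw [hj, hp] at h₂
    unfold letter at h₂
    split_ifs at h₂ <;> omega
  have h' : [2] ++ [0, 1] ++ stair 0 k ++ [0, 1] ++ [k + 2] = p ++ Y ++ m ++ Y ++ s := by
    rw [← h]; simp
  obtain ⟨h', hs⟩ := List.append_inj h' (by simp [length_stair]; omega)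
  obtain ⟨h', -⟩ := List.append_inj h' (by simp [length_stair]; omega)
  obtain ⟨h', hm⟩ := List.append_inj h' (by simp; omega)
  obtain ⟨h', -⟩ := List.append_inj h' (by simp; omega)
  exact ⟨h'.symm, hm.symm, hs.symm⟩

lemma even_count_flatMap_stair (F : ℕ → List ℕ) (a i n : ℕ) :
    Even ((F (i + 2)).count a + ((stair i n).flatMap F).count a +
      (F (i + n + 2)).count a) := by
  induction n with
  | zero => simp [stair]
  | succ n ih =>
    rw [stair_succ_right, List.flatMap_append]
    simp only [List.flatMap_cons, List.flatMap_nil, List.append_nil, List.count_append]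
    have e : i + (n + 1) + 2 = i + n + 3 := by omega
    rw [e]
    obtain ⟨c, hc⟩ := ih
    exact ⟨c + (F (i + n + 3)).count a, by omega⟩

/-- A substitution fixing the first singly occurring letter cannot change the length of a
staircase. -/
lemma eq_of_flatMap_stair (F : ℕ → List ℕ) {i n k : ℕ} (hF : F (i + 2) = [i + 2])
    (h : (stair i n).flatMap F = stair i k) : n = k := by
  induction n generalizing i k with
  | zero =>
    have := congrArg List.length h
    rw [length_stair] at this
    simp [stair] at this
    omega
  | succ n ih =>
    match k with
    | 0 => simp [stair, hF] at h
    | k + 1 =>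
      simp only [stair, List.flatMap_cons, hF] at h
      have hnot : i + 2 ∉ stair (i + 1) k := fun hm => by
        have := le_of_mem_stair hm
        omega
      match hT : F (i + 3) with
      | [] => rw [hT] at h; simp at h
      | [a] =>
        rw [hT] at h
        simp at h
        rw [ih (by rw [show i + 1 + 2 = i + 3 by omega, hT, h.1]) h.2]
      | a :: b :: T =>
        rw [hT] at h
        simp only [List.cons_append, List.cons.injEq] at h
        exact absurd (h.2.2 ▸ by simp) hnot

lemma eq_of_factor {n k : ℕ} (hk : 2 ≤ k) (F : ℕ → List ℕ) {Y a b : List ℕ}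
    (hY : 2 ≤ Y.length)
    (h : [2, 0, 1] ++ stair 0 k ++ [0, 1, k + 2] =
      a ++ (F 2 ++ Y ++ (stair 0 n).flatMap F ++ Y ++ F (n + 2)) ++ b) : n = k := by
  obtain ⟨hp, hm, hs⟩ := eq_of_repeated_factor hk (p := a ++ F 2) (Y := Y)
    (m := (stair 0 n).flatMap F) (s := F (n + 2) ++ b) hY (by rw [h]; simp)
  refine eq_of_flatMap_stair F (i := 0) ?_ hm
  have hev := even_count_flatMap_stair F 2 0 n
  have hlast : (F (n + 2)).count 2 = 0 := by
    have := congrArg (List.count 2) hs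
    rw [List.count_append, List.count_eq_zero_of_not_mem (l := [k + 2]) (by simp; omega)] at this
    omega
  have hmid : (stair 0 k).count 2 = 1 := by
    obtain ⟨k, rfl⟩ : ∃ l, k = l + 1 := ⟨k - 1, by omega⟩
    have : 2 ∉ stair 1 k := fun hm => by
      have := le_of_mem_stair hm
      omega
    simp [stair, List.count_eq_zero_of_not_mem this]
  rw [hm, hmid] at hev
  simp only [zero_add, hlast] at hev
  rcases List.append_eq_singleton_iff.1 hp with ⟨-, h₂⟩ | ⟨-, h₂⟩
  · exact h₂
  · rw [h₂] at hev
    simp at hev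

theorem statement1 (n k : ℕ) (hn : 3 ≤ n) (hk : 3 ≤ k) (hnk : n ≠ k)
    (θ : Word →* Word) :
    (IsFactor (θ (wn n)) (wn k) → θ (wn n) = θ (wn' n)) ∧
    (IsFactor (θ (wn' n)) (wn k) → θ (wn n) = θ (wn' n)) := by
  set F : ℕ → List ℕ := fun a => (θ (FreeMonoid.of a)).toList with hF
  have e : (θ (wn n)).toList =
      F 2 ++ (F 0 ++ F 1) ++ (stair 0 n).flatMap F ++ (F 0 ++ F 1) ++ F (n + 2) := by
    rw [toList_map_eq_flatMap, toList_wn]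
    simp [F]
  have e' : (θ (wn' n)).toList =
      F 2 ++ (F 1 ++ F 0) ++ (stair 0 n).flatMap F ++ (F 1 ++ F 0) ++ F (n + 2) := by
    rw [toList_map_eq_flatMap, toList_wn']
    simp [F]
  by_cases h : F 0 = [] ∨ F 1 = []
  · have : θ (wn n) = θ (wn' n) := by
      apply FreeMonoid.toList.injective
      rw [e, e']
      rcases h with h | h <;> simp [h]
    exact ⟨fun _ => this, fun _ => this⟩
  · push Not at h
    have h₀ := List.length_pos_iff.2 h.1
    have h₁ := List.length_pos_iff.2 h.2
    constructor <;> rintro ⟨a, b, hab⟩ <;> refine absurd ?_ hnk <;>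
      have hab := congrArg FreeMonoid.toList hab <;>
      rw [FreeMonoid.toList_mul, FreeMonoid.toList_mul, toList_wn] at hab
    · rw [e] at hab
      exact eq_of_factor (by omega) F (by simp; omega) hab
    · rw [e'] at hab
      exact eq_of_factor (by omega) F (by simp; omega) hab
end

section
/- Let M be any monoid for which the word xyxy (x, y distinct variables) is an isoterm. Then the set of Birkhoff-closed sets of identities containing Th(M) has cardinality 2^ℵ₀; that is, the monoid variety generated by M has continuum many subvarieties. -/
/-- A monoid `M` satisfies the identity `u ≈ v` if every monoid homomorphism
from the free monoid `A*` to `M` identifies `u` and `v`. -/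
def Satisfies (M : Type*) [Monoid M] (u v : Word) : Prop :=
  ∀ f : Word →* M, f u = f v

/-- A word `w` is an isoterm for a monoid `M` if the only word `w'` with
`M ⊨ w ≈ w'` is `w' = w`. -/
def Isoterm (M : Type*) [Monoid M] (w : Word) : Prop :=
  ∀ w' : Word, Satisfies M w w' → w' = w

/-- The set of identities satisfied by the monoid `M`. -/
def Th (M : Type*) [Monoid M] : Set (Word × Word) :=
  {p | Satisfies M p.1 p.2}

/-- A set `E` of identities is Birkhoff-closed if every identity satisfied by
every monoid satisfying all identities of `E` already belongs to `E`. -/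
def BirkhoffClosed (E : Set (Word × Word)) : Prop :=
  ∀ u v : Word,
    (∀ (M : Type) [Monoid M], (∀ p ∈ E, Satisfies M p.1 p.2) → Satisfies M u v) →
    (u, v) ∈ E

open FreeMonoid

section Words

/-- The number of occurrences of the letter `p` in the word `w`. -/
def occ (p : ℕ) (w : Word) : ℕ := w.toList.count p

@[simp] lemma occ_one (p : ℕ) : occ p 1 = 0 := by simp [occ]

@[simp] lemma occ_mul (p : ℕ) (u v : Word) : occ p (u * v) = occ p u + occ p v := by
  simp [occ]

lemma occ_of (p q : ℕ) : occ p (of q) = if q = p then 1 else 0 := by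
  simp [occ, List.count_singleton]

/-- A homomorphism that erases every letter of `w` except `x` maps `w` to a power. -/
lemma hom_eq_pow {N : Type*} [Monoid N] (g : Word →* N) (x : ℕ) (w : Word)
    (h : ∀ z, occ z w ≠ 0 → z ≠ x → g (of z) = 1) : g w = g (of x) ^ occ x w := by
  induction w using FreeMonoid.inductionOn' with
  | one => simp
  | of_mul z w ih =>
    rw [map_mul, ih fun y hy => h y (by simp [hy]), occ_mul, occ_of]
    by_cases hz : z = x
    · simp [hz, pow_add]
    · rw [h z (by simp [occ_of]) hz]
      simp [hz]

/-- Two homomorphisms agreeing on the letters of `w` agree on `w`. -/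
lemma hom_congr_occ {N : Type*} [Monoid N] (g k : Word →* N) (w : Word)
    (h : ∀ z, occ z w ≠ 0 → g (of z) = k (of z)) : g w = k w := by
  induction w using FreeMonoid.inductionOn' with
  | one => simp
  | of_mul z w ih =>
    rw [map_mul, map_mul, ih fun y hy => h y (by simp [hy]), h z (by simp [occ_of])]

lemma occ_hom (p : ℕ) (θ : Word →* Word) (u : Word) :
    occ p (θ u) = ∑ z ∈ u.toList.toFinset, occ z u * occ p (θ (of z)) := by
  have h : occ p (θ u) = (u.toList.map fun z => occ p (θ (of z))).sum := by
    induction u using FreeMonoid.inductionOn' with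
    | one => simp
    | of_mul z w ih => simp [ih]
  rw [h, Finset.sum_list_map_count]
  rfl

lemma exists_split_of_occ_eq_one {p : ℕ} {w : Word} (h : occ p w = 1) :
    ∃ s t : Word, w = s * of p * t ∧ occ p s = 0 ∧ occ p t = 0 := by
  have hp : p ∈ w.toList := List.count_pos_iff.1 (by unfold occ at h; omega)
  obtain ⟨s, t, hst⟩ := List.append_of_mem hp
  have hw : w = ofList s * of p * ofList t := by
    apply toList.injective
    simp [hst]
  refine ⟨ofList s, ofList t, hw, ?_⟩
  rw [hw] at h
  simp only [occ_mul, occ_of, if_true] at h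
  omega

end Words

section Crossing

/-- The projection of words onto the two letters `i` and `j`, renamed to `0` and `1`. -/
def proj (i j : ℕ) : Word →* Word :=
  FreeMonoid.lift fun k => if k = i then of 0 else if k = j then of 1 else 1

lemma proj_of (i j k : ℕ) :
    proj i j (of k) = if k = i then of 0 else if k = j then of 1 else 1 := by
  simp [proj]

instance : DecidableEq Word := inferInstanceAs (DecidableEq (List ℕ))

/-- The word `xyxy`. -/
def alt : Word := FreeMonoid.ofList [0, 1, 0, 1]

/-- The letters `i` and `j` alternate in `w`, each occurring twice. -/
def Crosses (w : Word) (i j : ℕ) : Prop := proj i j w = alt ∨ proj j i w = alt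

lemma Crosses.symm {w : Word} {i j : ℕ} (h : Crosses w i j) : Crosses w j i := Or.symm h

lemma occ_zero_proj (i j : ℕ) (w : Word) : occ 0 (proj i j w) = occ i w := by
  induction w using FreeMonoid.inductionOn' with
  | one => simp
  | of_mul z w ih =>
    rw [map_mul, occ_mul, ih, occ_mul, proj_of, occ_of]
    split_ifs <;> simp [occ_of]

lemma Crosses.occ_left {w : Word} {i j : ℕ} (hij : i ≠ j) (h : Crosses w i j) :
    occ i w = 2 := by
  have h1 : occ 1 (proj j i w) = occ i w := by
    clear h
    induction w using FreeMonoid.inductionOn' with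
    | one => simp
    | of_mul z w ih =>
      rw [map_mul, occ_mul, ih, occ_mul, proj_of, occ_of]
      split_ifs <;> simp_all [occ_of]
  rcases h with h | h
  · rw [← occ_zero_proj i j, h]; rfl
  · rw [← h1, h]; rfl

lemma proj_eq_left_pow {i j : ℕ} {w : Word} (h : occ j w = 0) :
    proj i j w = of 0 ^ occ i w := by
  rw [hom_eq_pow (proj i j) i w, proj_of, if_pos rfl]
  intro z hz hzi
  have : z ≠ j := by rintro rfl; exact hz h
  simp [proj_of, hzi, this]

lemma proj_eq_right_pow {i j : ℕ} (hij : i ≠ j) {w : Word} (h : occ i w = 0) :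
    proj i j w = of 1 ^ occ j w := by
  rw [hom_eq_pow (proj i j) j w, proj_of, if_neg hij.symm, if_pos rfl]
  intro z hz hzj
  have : z ≠ i := by rintro rfl; exact hz h
  simp [proj_of, hzj, this]

lemma proj_of_occ_eq_one {i j : ℕ} (hij : i ≠ j) {w : Word} (hi : occ i w = 1)
    (hj : occ j w = 1) : proj i j w = of 0 * of 1 ∨ proj i j w = of 1 * of 0 := by
  obtain ⟨s, t, rfl, hs, ht⟩ := exists_split_of_occ_eq_one hi
  simp only [occ_mul, occ_of, if_neg hij] at hj
  rw [map_mul, map_mul, proj_eq_right_pow hij hs, proj_eq_right_pow hij ht, proj_of, if_pos rfl]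
  obtain ⟨h1, h2⟩ | ⟨h1, h2⟩ : (occ j s = 0 ∧ occ j t = 1) ∨ (occ j s = 1 ∧ occ j t = 0) := by
    omega
  · left; simp [h1, h2]
  · right; simp [h1, h2]

lemma proj_swap (i j : ℕ) (hij : i ≠ j) (w : Word) :
    proj j i w = proj 1 0 (proj i j w) := by
  induction w using FreeMonoid.inductionOn' with
  | one => simp
  | of_mul z w ih =>
    rw [map_mul, map_mul, map_mul, ih, proj_of, proj_of]
    split_ifs <;> simp_all [proj_of]

/-- If `i` and `j` cross, then `j` occurs between the two occurrences of `i`. -/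
lemma Crosses.occ_ne_zero_of_factor {a b w : Word} {i j : ℕ} (hij : i ≠ j)
    (h : Crosses (a * w * b) i j) (ha : occ i a = 0) (hb : occ i b = 0) :
    occ j w ≠ 0 := by
  intro hj
  have hi : occ i w = 2 := by
    have := h.occ_left hij
    simp only [occ_mul] at this
    omega
  have hj2 := h.symm.occ_left hij.symm
  simp only [occ_mul] at hj2
  have e : proj i j (a * w * b) = of 1 ^ occ j a * of 0 ^ 2 * of 1 ^ occ j b := by
    rw [map_mul, map_mul, proj_eq_right_pow hij ha, proj_eq_right_pow hij hb,
      proj_eq_left_pow hj, hi]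
  unfold Crosses at h
  rw [proj_swap i j hij, e] at h
  obtain ⟨h1, h2⟩ | ⟨h1, h2⟩ | ⟨h1, h2⟩ : (occ j a = 0 ∧ occ j b = 2) ∨
      (occ j a = 1 ∧ occ j b = 1) ∨ (occ j a = 2 ∧ occ j b = 0) := by omega
  all_goals
    rw [h1, h2] at h
    revert h
    decide

end Crossing

section Cycle

/-- Adjacency in the cycle with vertices `0, …, n - 1`. -/
def CycleAdj (n i j : ℕ) : Prop :=
  i + 1 = j ∨ j + 1 = i ∨ (i = 0 ∧ j + 1 = n) ∨ (j = 0 ∧ i + 1 = n)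

/-- The words in which the letters `0, …, n - 1` cross in the pattern of an `n`-cycle. -/
def cycleWords (n : ℕ) : Set Word :=
  {w | ∀ i j, i < n → j < n → i ≠ j → (Crosses w i j ↔ CycleAdj n i j)}

lemma exists_cycleAdj {n : ℕ} (hn : 4 ≤ n) {i : ℕ} (hi : i < n) :
    ∃ j k, j < n ∧ k < n ∧ j ≠ k ∧ i ≠ j ∧ i ≠ k ∧ CycleAdj n i j ∧ CycleAdj n i k := by
  unfold CycleAdj
  by_cases h0 : i = 0
  · exact ⟨1, n - 1, by omega⟩
  by_cases h1 : i + 1 = n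
  · exact ⟨0, i - 1, by omega⟩
  · exact ⟨i - 1, i + 1, by omega⟩

lemma cycle_induction {n : ℕ} (Q : ℕ → Prop)
    (hQ : ∀ i j, i < n → j < n → CycleAdj n i j → Q i → Q j)
    {i : ℕ} (hi : i < n) (h : Q i) : ∀ j < n, Q j := by
  have h0 : Q 0 := by
    induction i with
    | zero => exact h
    | succ i ih =>
      exact ih (by omega) (hQ _ _ hi (by omega) (by unfold CycleAdj; omega) h)
  intro j hj
  induction j with
  | zero => exact h0
  | succ j ih => exact hQ _ _ (by omega) hj (by unfold CycleAdj; omega) (ih (by omega))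

/-- Distinct vertices of a cycle of length at least four are not adjacent twins. -/
lemma cycle_injOn {m : ℕ} (hm : 4 ≤ m) {f : ℕ → ℕ} {R : ℕ → ℕ → Prop}
    (h : ∀ p q, p < m → q < m → p ≠ q → (CycleAdj m p q ↔ f p = f q ∨ R (f p) (f q)))
    {p q : ℕ} (hp : p < m) (hq : q < m) (hpq : f p = f q) : p = q := by
  by_contra hne
  have h1 : CycleAdj m p q := (h p q hp hq hne).2 (Or.inl hpq)
  obtain ⟨j, k, hj, hk, hjk, hqj, hqk, aj, ak⟩ := exists_cycleAdj hm hq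
  obtain ⟨r, hr, hrp, hqr, ar⟩ : ∃ r, r < m ∧ p ≠ r ∧ q ≠ r ∧ CycleAdj m q r := by
    by_cases hjp : p = j
    · exact ⟨k, hk, by omega, hqk, ak⟩
    · exact ⟨j, hj, hjp, hqj, aj⟩
  have h2 := (h q r hq hr hqr).1 ar
  rw [← hpq] at h2
  have h3 := (h p r hp hr hrp).2 h2
  unfold CycleAdj at *
  omega

lemma cycle_rigid {m n : ℕ} (hm : 4 ≤ m) (hn : 4 ≤ n) {f : ℕ → ℕ} (hf : ∀ p < m, f p < n)
    (h : ∀ p q, p < m → q < m → p ≠ q →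
      (CycleAdj m p q ↔ f p = f q ∨ CycleAdj n (f p) (f q))) : m = n := by
  have inj : ∀ p q, p < m → q < m → f p = f q → p = q :=
    fun p q hp hq => cycle_injOn hm h hp hq
  have surj : ∀ z < n, ∃ p < m, f p = z := by
    refine cycle_induction (i := f 0) _ ?_ (hf 0 (by omega)) ⟨0, by omega, rfl⟩
    rintro _ z hy hz hyz ⟨p, hp, rfl⟩
    obtain ⟨j, k, hj, hk, hjk, hpj, hpk, aj, ak⟩ := exists_cycleAdj hm hp
    have ej := (h p j hp hj hpj).1 aj
    have ek := (h p k hp hk hpk).1 ak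
    have nj : f p ≠ f j := fun e => hpj (inj _ _ hp hj e)
    have nk : f p ≠ f k := fun e => hpk (inj _ _ hp hk e)
    have njk : f j ≠ f k := fun e => hjk (inj _ _ hj hk e)
    have : f j = z ∨ f k = z := by
      have := hf j hj
      have := hf k hk
      unfold CycleAdj at ej ek hyz
      omega
    rcases this with e | e
    · exact ⟨j, hj, e⟩
    · exact ⟨k, hk, e⟩
  apply le_antisymm
  · simpa using Finset.card_le_card_of_injOn (s := Finset.range m) (t := Finset.range n) f
      (fun p hp => by simpa using hf p (by simpa using hp))
      (fun p hp q hq => inj p q (by simpa using hp) (by simpa using hq))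
  · simpa using Finset.card_le_card_of_surjOn (s := Finset.range m) (t := Finset.range n) f
      (fun z hz => by
        obtain ⟨p, hp, e⟩ := surj z (by simpa using hz)
        exact ⟨p, by simpa using hp, e⟩)

end Cycle

section Substitution

/-- If `a * θ u * b` has `p` exactly twice and `p` occurs in the image of a letter `x` of `u`,
then `x` is the only letter of `u` whose image contains `p`. -/
lemma occ_of_occ_eq_two {a b u : Word} {θ : Word →* Word}
    (hu : ∀ z, occ z u ≠ 0 → occ z u = 2) {p x : ℕ} (hp : occ p (a * θ u * b) = 2)
    (hx : occ x u ≠ 0) (hpx : occ p (θ (of x)) ≠ 0) :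
    occ p a = 0 ∧ occ p b = 0 ∧ occ p (θ (of x)) = 1 ∧
      ∀ z, occ z u ≠ 0 → z ≠ x → occ p (θ (of z)) = 0 := by
  have mem : ∀ z, occ z u ≠ 0 ↔ z ∈ u.toList.toFinset := fun z => by
    simp [occ, List.count_eq_zero]
  have hs : occ p (θ u) = 2 * ∑ z ∈ u.toList.toFinset, occ p (θ (of z)) := by
    rw [occ_hom, Finset.mul_sum]
    exact Finset.sum_congr rfl fun z hz => by rw [hu z ((mem z).2 hz)]
  rw [← Finset.add_sum_erase _ _ ((mem x).1 hx)] at hs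
  simp only [occ_mul] at hp
  refine ⟨by omega, by omega, by omega, fun z hz hzx => ?_⟩
  have h0 : ∑ z ∈ u.toList.toFinset.erase x, occ p (θ (of z)) = 0 := by omega
  exact Finset.sum_eq_zero_iff.1 h0 z (Finset.mem_erase.2 ⟨hzx, (mem z).1 hz⟩)

lemma exists_letter_map {m : ℕ} (hm : 4 ≤ m) {a b u : Word} {θ : Word →* Word}
    (hu : ∀ z, occ z u ≠ 0 → occ z u = 2) (hw : a * θ u * b ∈ cycleWords m)
    (hne : ∃ p < m, ∃ x, occ x u ≠ 0 ∧ occ p (θ (of x)) ≠ 0) :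
    ∃ f : ℕ → ℕ, (∀ p < m, occ (f p) u ≠ 0) ∧
      ∀ p q, p < m → q < m → p ≠ q →
        (CycleAdj m p q ↔ f p = f q ∨ Crosses u (f p) (f q)) := by
  obtain ⟨p₀, hp₀, x₀, hx₀⟩ := hne
  have two : ∀ p < m, occ p (a * θ u * b) = 2 := fun p hp => by
    obtain ⟨j, -, hj, -, -, hpj, -, aj, -⟩ := exists_cycleAdj hm hp
    exact ((hw p j hp hj hpj).2 aj).occ_left hpj
  have owned : ∀ p < m, ∃ x, occ x u ≠ 0 ∧ occ p (θ (of x)) ≠ 0 := by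
    refine cycle_induction _ ?_ hp₀ ⟨x₀, hx₀⟩
    rintro p q hp hq hpq ⟨x, hx, hpx⟩
    have hne : p ≠ q := by unfold CycleAdj at hpq; omega
    obtain ⟨ha, hb, -, -⟩ := occ_of_occ_eq_two hu (two p hp) hx hpx
    have h := ((hw p q hp hq hne).2 hpq).occ_ne_zero_of_factor hne ha hb
    rw [occ_hom] at h
    obtain ⟨y, -, hy⟩ := Finset.exists_ne_zero_of_sum_ne_zero h
    exact ⟨y, left_ne_zero_of_mul hy, right_ne_zero_of_mul hy⟩
  choose! f hfu hfp using owned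
  refine ⟨f, hfu, fun p q hp hq hpq => ?_⟩
  obtain ⟨pa, pb, p1, p0⟩ := occ_of_occ_eq_two hu (two p hp) (hfu p hp) (hfp p hp)
  obtain ⟨qa, qb, q1, q0⟩ := occ_of_occ_eq_two hu (two q hq) (hfu q hq) (hfp q hq)
  rw [← hw p q hp hq hpq]
  have e : ∀ i j, occ i a = 0 → occ j a = 0 → occ i b = 0 → occ j b = 0 →
      proj i j (a * θ u * b) = proj i j (θ u) := by
    intro i j h1 h2 h3 h4
    rw [map_mul, map_mul, proj_eq_left_pow h2, proj_eq_left_pow h4, h1, h3]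
    simp
  by_cases hf : f p = f q
  · simp only [hf, true_or, iff_true]
    have h2 : proj p q (θ u) = proj p q (θ (of (f q))) ^ 2 := by
      rw [← hu _ (hfu q hq)]
      refine hom_eq_pow ((proj p q).comp θ) (f q) u fun z hz hzx => ?_
      rw [MonoidHom.comp_apply, proj_eq_left_pow (q0 z hz hzx), p0 z hz (hf ▸ hzx), pow_zero]
    rw [hf] at p1
    unfold Crosses
    rw [proj_swap p q hpq, e p q pa qa pb qb, h2]
    rcases proj_of_occ_eq_one hpq p1 q1 with h3 | h3 <;> rw [h3] <;> decide
  · have key : ∀ i j, i ≠ j → f i ≠ f j → occ i (θ (of (f i))) = 1 → occ j (θ (of (f j))) = 1 →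
        (∀ z, occ z u ≠ 0 → z ≠ f i → occ i (θ (of z)) = 0) →
        (∀ z, occ z u ≠ 0 → z ≠ f j → occ j (θ (of z)) = 0) →
        proj i j (θ u) = proj (f i) (f j) u := by
      intro i j hij hfij i1 j1 i0 j0
      refine hom_congr_occ ((proj i j).comp θ) (proj (f i) (f j)) u fun z hz => ?_
      rw [MonoidHom.comp_apply, proj_of]
      split_ifs with h1 h2
      · subst h1
        rw [proj_eq_left_pow (j0 _ hz hfij), i1, pow_one]
      · subst h2
        rw [proj_eq_right_pow hij (i0 _ hz h1), j1, pow_one]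
      · rw [proj_eq_left_pow (j0 _ hz h2), i0 z hz h1, pow_zero]
    unfold Crosses
    rw [e p q pa qa pb qb, e q p qa pa qb pb, key p q hpq hf p1 q1 p0 q0,
      key q p (Ne.symm hpq) (Ne.symm hf) q1 p1 q0 p0]
    simp [hf]

end Substitution

section Identities

/-- The word `x₁x₀ x₂x₁ ⋯ xₖxₖ₋₁`. -/
def pathWord : ℕ → Word
  | 0 => 1
  | k + 1 => pathWord k * of (k + 1) * of k

/-- A word in which the letters `x₀, …, xₙ₋₁` cross in the pattern of an `n`-cycle. -/
def cycleWord (n : ℕ) : Word := pathWord (n - 1) * of 0 * of (n - 1)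

lemma proj_pathWord_succ (i k : ℕ) : proj i (i + 1) (pathWord k) =
    (if 1 ≤ i ∧ i ≤ k then of 0 else 1) * (if i + 1 ≤ k then of 1 * of 0 else 1) *
      (if i + 2 ≤ k then of 1 else 1) := by
  induction k with
  | zero =>
    rw [if_neg (by omega : ¬ (1 ≤ i ∧ i ≤ 0))]
    simp [pathWord]
  | succ k ih =>
    rw [pathWord, map_mul, map_mul, ih, proj_of, proj_of]
    split_ifs <;> first | omega | simp [mul_assoc]

lemma proj_pathWord_of_lt {i j : ℕ} (hij : i + 1 < j) (k : ℕ) : proj i j (pathWord k) =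
    (if 1 ≤ i ∧ i ≤ k then of 0 else 1) * (if i + 1 ≤ k then of 0 else 1) *
      (if j ≤ k then of 1 else 1) * (if j + 1 ≤ k then of 1 else 1) := by
  induction k with
  | zero =>
    rw [if_neg (by omega : ¬ (1 ≤ i ∧ i ≤ 0)), if_neg (by omega : ¬ j ≤ 0)]
    simp [pathWord]
  | succ k ih =>
    rw [pathWord, map_mul, map_mul, ih, proj_of, proj_of]
    obtain h | h | h | h | h | h | h : k + 1 < i ∨ k + 1 = i ∨ k = i ∨ (i < k ∧ k + 1 < j) ∨
        k + 1 = j ∨ k = j ∨ j < k := by omega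
    all_goals
      rcases Nat.eq_zero_or_pos i with h0 | h0 <;>
        first
        | omega
        | simp (disch := omega) only [if_pos, if_neg, one_mul, mul_one]

lemma crosses_cycleWord_of_lt {n i j : ℕ} (hn : 4 ≤ n) (hij : i < j) (hj : j < n) :
    Crosses (cycleWord n) i j ↔ CycleAdj n i j := by
  unfold Crosses
  rw [proj_swap i j hij.ne, cycleWord, map_mul, map_mul, proj_of, proj_of]
  unfold CycleAdj
  obtain h | h : j = i + 1 ∨ i + 1 < j := by omega
  · rw [h, proj_pathWord_succ, if_neg (by omega : ¬ 0 = i + 1)]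
    refine iff_of_true ?_ (Or.inl rfl)
    split_ifs <;> first | omega | decide
  · rw [proj_pathWord_of_lt h]
    by_cases h0 : i = 0 ∧ j + 1 = n
    · refine iff_of_true ?_ (by omega)
      split_ifs <;> first | omega | decide
    · refine iff_of_false ?_ (by omega)
      split_ifs <;> first | omega | decide

lemma crosses_comm {w : Word} {i j : ℕ} : Crosses w i j ↔ Crosses w j i := Or.comm

lemma cycleWord_mem {n : ℕ} (hn : 4 ≤ n) : cycleWord n ∈ cycleWords n := by
  intro i j hi hj hij
  rcases lt_or_gt_of_ne hij with h | h
  · exact crosses_cycleWord_of_lt hn h hj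
  · rw [crosses_comm, crosses_cycleWord_of_lt hn h hi]
    unfold CycleAdj
    omega

lemma occ_cycleWord {n : ℕ} (hn : 4 ≤ n) (z : ℕ) :
    occ z (cycleWord n) = if z < n then 2 else 0 := by
  split_ifs with hz
  · obtain ⟨j, -, hj, -, -, hzj, -, aj, -⟩ := exists_cycleAdj hn hz
    exact ((cycleWord_mem hn z j hz hj hzj).2 aj).occ_left hzj
  · have h : ∀ k < n, occ z (pathWord k) = 0 := by
      intro k hk
      induction k with
      | zero => simp [pathWord]
      | succ k ih =>
        rw [pathWord, occ_mul, occ_mul, ih (by omega), occ_of, occ_of, if_neg (by omega),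
          if_neg (by omega)]
    rw [cycleWord, occ_mul, occ_mul, h _ (by omega), occ_of, occ_of, if_neg (by omega),
      if_neg (by omega)]

/-- The endomorphism squaring every letter. -/
def squareHom : Word →* Word := FreeMonoid.lift fun i => of i * of i

/-- The word `x₀² x₁² ⋯ xₙ₋₁²`. -/
def squareWord (n : ℕ) : Word := squareHom (ofList (List.range n))

lemma occ_squareWord (n z : ℕ) : occ z (squareWord n) = if z < n then 2 else 0 := by
  have h : ∀ w, occ z (squareHom w) = 2 * occ z w := by
    intro w
    induction w using FreeMonoid.inductionOn' with
    | one => simp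
    | of_mul y w ih => rw [map_mul, occ_mul, occ_mul, ih]; simp [squareHom]; ring
  rw [squareWord, h, occ, toList_ofList, List.nodup_range.count]
  simp

lemma not_crosses_squareWord (n i j : ℕ) : ¬ Crosses (squareWord n) i j := by
  have h : ∀ i j w, proj i j (squareHom w) = squareHom (proj i j w) := by
    intro i j w
    induction w using FreeMonoid.inductionOn' with
    | one => simp
    | of_mul y w ih =>
      rw [map_mul, map_mul, map_mul, map_mul, ih, proj_of]
      split_ifs <;> simp_all [squareHom, proj_of]
  have h2 : ∀ w, squareHom w ≠ alt := by
    intro w hw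
    induction w using FreeMonoid.inductionOn' with
    | one => exact absurd hw (by rw [map_one]; decide)
    | of_mul y w ih =>
      have := congrArg toList hw
      simp only [squareHom, alt, map_mul, lift_eval_of, toList_mul, toList_of, toList_ofList,
        List.cons_append, List.nil_append, List.cons.injEq] at this
      omega
  rintro (hc | hc) <;> exact h2 _ ((h _ _ _).symm.trans hc)

lemma cycleWords_iff_of_ne {m n : ℕ} (hm : 4 ≤ m) (hn : 4 ≤ n) (hmn : m ≠ n) (a b : Word)
    (θ : Word →* Word) :
    a * θ (cycleWord n) * b ∈ cycleWords m ↔ a * θ (squareWord n) * b ∈ cycleWords m := by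
  have hu := occ_cycleWord hn
  have hv := occ_squareWord n
  by_cases hne : ∃ p < m, ∃ x < n, occ p (θ (of x)) ≠ 0
  · obtain ⟨p, hp, x, hx, hpx⟩ := hne
    refine iff_of_false (fun h => ?_) (fun h => ?_)
    · obtain ⟨f, hf, hf'⟩ := exists_letter_map hm (fun z => by rw [hu]; split_ifs <;> simp) h
        ⟨p, hp, x, by simp [hu, hx], hpx⟩
      have hfn : ∀ p < m, f p < n := fun p hp => by
        by_contra hc
        exact hf p hp (by rw [hu, if_neg hc])
      refine hmn (cycle_rigid hm hn hfn fun p q hp hq hpq => ?_)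
      rw [hf' p q hp hq hpq]
      by_cases he : f p = f q
      · simp [he]
      · rw [cycleWord_mem hn _ _ (hfn p hp) (hfn q hq) he]
    · obtain ⟨f, -, hf'⟩ := exists_letter_map hm (fun z => by rw [hv]; split_ifs <;> simp) h
        ⟨p, hp, x, by simp [hv, hx], hpx⟩
      have h01 := (hf' 0 1 (by omega) (by omega) (by omega)).1 (by simp [CycleAdj])
      exact absurd (cycle_injOn hm hf' (by omega) (by omega)
        (h01.resolve_right (not_crosses_squareWord n _ _))) (by omega)
  · push Not at hne
    have erase : ∀ w : Word, (∀ z, occ z w = if z < n then 2 else 0) → ∀ i j, i < m → j < m →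
        proj i j (θ w) = 1 := by
      intro w hw i j hi hj
      refine hom_congr_occ ((proj i j).comp θ) 1 w fun z hz => ?_
      have hzn : z < n := by
        by_contra hc
        exact hz (by rw [hw, if_neg hc])
      rw [MonoidHom.comp_apply, proj_eq_left_pow (hne j hj z hzn), hne i hi z hzn]
      simp
    refine forall₂_congr fun i j => forall₃_congr fun hi hj hij => ?_
    simp only [Crosses, map_mul, erase _ hu i j hi hj, erase _ hu j i hj hi,
      erase _ hv i j hi hj, erase _ hv j i hj hi]

lemma squareWord_notMem {n : ℕ} (hn : 4 ≤ n) : squareWord n ∉ cycleWords n := fun h =>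
  not_crosses_squareWord n 0 1
    ((h 0 1 (by omega) (by omega) (by omega)).2 (by simp [CycleAdj]))

end Identities

section Varieties

/-- The common syntactic congruence of a family of languages. -/
def syntacticCon {ι : Type*} (L : ι → Set Word) : Con Word where
  r u v := ∀ i a b, a * u * b ∈ L i ↔ a * v * b ∈ L i
  iseqv := ⟨fun _ _ _ _ => Iff.rfl, fun h i a b => (h i a b).symm,
    fun h k i a b => (h i a b).trans (k i a b)⟩
  mul' {u v w z} h k i a b := by
    have h1 := h i a (w * b)
    have h2 := k i (a * v) b
    simp only [mul_assoc] at h1 h2 ⊢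
    exact h1.trans h2

lemma satisfies_quotient_iff (c : Con Word) (u v : Word) :
    Satisfies c.Quotient u v ↔ ∀ θ : Word →* Word, c (θ u) (θ v) := by
  constructor
  · intro h θ
    exact (Con.eq c).1 (h (c.mk'.comp θ))
  · intro h f
    have hf : f = c.mk'.comp (FreeMonoid.lift fun i => Quotient.out (f (of i))) := by
      ext i
      simp only [MonoidHom.comp_apply, lift_eval_of]
      exact (Quotient.out_eq (f (of i))).symm
    rw [hf]
    exact (Con.eq c).2 (h _)

lemma birkhoffClosed_Th (Q : Type) [Monoid Q] : BirkhoffClosed (Th Q) :=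
  fun _ _ h => h Q fun _ hp => hp

lemma mem_cycleWords_of_satisfies {M : Type*} [Monoid M] (h : Isoterm M alt) {u v : Word}
    (huv : Satisfies M u v) (n : ℕ) : u ∈ cycleWords n ↔ v ∈ cycleWords n := by
  have key : ∀ i j, proj i j u = alt ↔ proj i j v = alt := by
    intro i j
    have hs : Satisfies M (proj i j u) (proj i j v) := fun f => huv (f.comp (proj i j))
    constructor
    · intro e
      exact h _ (e ▸ hs)
    · intro e
      exact h _ (e ▸ fun f => (hs f).symm)
  simp only [cycleWords, Set.mem_ofPred_eq, Crosses, key]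

/-- The identities compatible with the cycle languages of length `n + 4` for `n ∈ S`. -/
def cycleTheory (S : Set ℕ) : Set (Word × Word) :=
  Th (syntacticCon fun n : S => cycleWords (n + 4)).Quotient

lemma mem_cycleTheory_iff (S : Set ℕ) (n : ℕ) :
    (cycleWord (n + 4), squareWord (n + 4)) ∈ cycleTheory S ↔ n ∉ S := by
  refine Iff.trans (satisfies_quotient_iff _ _ _) ⟨fun h hn => ?_, fun hn θ i a b => ?_⟩
  · have h1 := h (MonoidHom.id _) ⟨n, hn⟩ 1 1
    simp only [one_mul, mul_one, MonoidHom.id_apply] at h1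
    exact squareWord_notMem (by omega) (h1.1 (cycleWord_mem (by omega)))
  · refine cycleWords_iff_of_ne (by omega) (by omega) (fun e => hn ?_) a b θ
    have : (i : ℕ) = n := by omega
    exact this ▸ i.2

lemma Th_subset_cycleTheory {M : Type*} [Monoid M] (h : Isoterm M alt) (S : Set ℕ) :
    Th M ⊆ cycleTheory S := by
  rintro ⟨u, v⟩ huv
  refine (satisfies_quotient_iff _ _ _).2 fun θ i a b => mem_cycleWords_of_satisfies h ?_ _
  intro f
  simp only [map_mul]
  rw [show f (θ u) = f (θ v) from huv (f.comp θ)]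

end Varieties

/-- If `xyxy` (with `x = 0`, `y = 1`) is an isoterm for a monoid `M`, then the monoid
variety generated by `M` has continuum many subvarieties. -/
theorem statement3 (M : Type*) [Monoid M]
    (h : Isoterm M (FreeMonoid.ofList [0, 1, 0, 1])) :
    Cardinal.mk {E : Set (Word × Word) // BirkhoffClosed E ∧ Th M ⊆ E} =
      Cardinal.continuum := by
  apply le_antisymm
  · have hc : Countable Word := inferInstanceAs (Countable (List ℕ))
    calc Cardinal.mk {E : Set (Word × Word) // BirkhoffClosed E ∧ Th M ⊆ E}
        ≤ Cardinal.mk (Set (Word × Word)) := Cardinal.mk_subtype_le _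
      _ = 2 ^ Cardinal.mk (Word × Word) := Cardinal.mk_set
      _ ≤ 2 ^ Cardinal.aleph0 :=
        Cardinal.power_le_power_left two_ne_zero Cardinal.mk_le_aleph0
      _ = Cardinal.continuum := Cardinal.two_power_aleph0
  · let F : Set ℕ → {E : Set (Word × Word) // BirkhoffClosed E ∧ Th M ⊆ E} :=
      fun S => ⟨cycleTheory S, birkhoffClosed_Th _, Th_subset_cycleTheory h S⟩
    have hF : Function.Injective F := by
      intro S T hST
      have e : cycleTheory S = cycleTheory T := congrArg Subtype.val hST
      ext n
      rw [← not_iff_not, ← mem_cycleTheory_iff, ← mem_cycleTheory_iff, e]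
    simpa using Cardinal.mk_le_of_injective hF
end

section
/- Let M be a finite monoid. Then the following are equivalent: (i) there exists a finite set Σ of semigroup identities such that the semigroup reduct of M satisfies Σ and every finitely generated semigroup satisfying Σ is finite; (ii) there exists a finite set Σ' of monoid identities such that M satisfies Σ' and every finitely generated monoid satisfying Σ' is finite. (Consequently, M is an inherently non-finitely based semigroup if and only if M is an inherently non-finitely based monoid.) -/
/-- A monoid is finitely generated if it is generated (as a monoid) by a finite subset. -/
def MonoidFG (M : Type*) [Monoid M] : Prop :=
  ∃ s : Set M, s.Finite ∧ Submonoid.closure s = ⊤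

/-- Nonempty words over the alphabet `A = ℕ`: elements of the free semigroup `A⁺`. -/
abbrev SWord : Type := FreeSemigroup ℕ

/-- A semigroup `S` satisfies the semigroup identity `u ≈ v`. -/
def SSatisfies (S : Type*) [Semigroup S] (u v : SWord) : Prop :=
  ∀ f : SWord →ₙ* S, f u = f v

/-- A semigroup is finitely generated if it is generated (as a semigroup)
by a finite subset. -/
def SemigroupFG (S : Type*) [Semigroup S] : Prop :=
  ∃ s : Set S, s.Finite ∧ Subsemigroup.closure s = ⊤

/-- The semigroup word obtained from `l` by renaming each letter `n` to `n + 1` and appending the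
fresh letter `0`. -/
def shiftAppend (l : List ℕ) : SWord :=
  l.foldr (fun n w => FreeSemigroup.of (n + 1) * w) (FreeSemigroup.of 0)

/-- The canonical embedding of nonempty words into words. -/
def toWord : SWord →ₙ* Word := FreeSemigroup.lift FreeMonoid.of

theorem map_toWord {N : Type*} [Monoid N] (f : Word →* N) (w : SWord) :
    f (toWord w) = FreeSemigroup.lift (fun n => f (FreeMonoid.of n)) w := by
  have h : (f : Word →ₙ* N).comp toWord =
      FreeSemigroup.lift (fun n => f (FreeMonoid.of n)) :=
    FreeSemigroup.hom_ext (by ext n; simp [toWord])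
  exact DFunLike.congr_fun h w

theorem satisfies_toWord_iff {N : Type*} [Monoid N] (u v : SWord) :
    Satisfies N (toWord u) (toWord v) ↔ SSatisfies N u v := by
  refine ⟨fun h g => ?_, fun h f => ?_⟩
  · have hg : FreeSemigroup.lift (fun n => g (FreeSemigroup.of n)) = g :=
      FreeSemigroup.hom_ext (by ext n; simp)
    have := h (FreeMonoid.lift fun n => g (FreeSemigroup.of n))
    simpa [map_toWord, hg] using this
  · simpa only [map_toWord] using h _

theorem MonoidFG.semigroupFG {N : Type*} [Monoid N] (h : MonoidFG N) : SemigroupFG N := by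
  obtain ⟨s, hs, hcl⟩ := h
  refine ⟨insert 1 s, hs.insert 1, ?_⟩
  refine eq_top_iff.2 fun x _ => ?_
  have hx : x ∈ Submonoid.closure s := hcl ▸ Submonoid.mem_top x
  induction hx using Submonoid.closure_induction with
  | mem x hx => exact Subsemigroup.subset_closure (Set.mem_insert_of_mem _ hx)
  | one => exact Subsemigroup.subset_closure (Set.mem_insert _ _)
  | mul x y _ _ ihx ihy => exact mul_mem (ihx trivial) (ihy trivial)

/-- The semigroup identities `u' t ≈ v' t`, where `u ≈ v` lies in `Sig`, the words `u'`, `v'` are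
obtained by deleting the same letters from `u` and `v`, and `t` is a fresh letter. -/
def deletionIdentities (Sig : Set (Word × Word)) : Set (SWord × SWord) :=
  {q | ∃ p ∈ Sig, ∃ P : ℕ → Bool, q =
    (shiftAppend (p.1.toList.filter P), shiftAppend (p.2.toList.filter P))}

theorem deletionIdentities_finite {Sig : Set (Word × Word)} (h : Sig.Finite) :
    (deletionIdentities Sig).Finite := by
  have hsub (l : List ℕ) : {w | ∃ l', List.Sublist l' l ∧ w = shiftAppend l'}.Finite := by
    refine (l.sublists.toFinset.finite_toSet.image shiftAppend).subset ?_
    rintro _ ⟨l', hl', rfl⟩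
    exact ⟨l', by simpa using hl', rfl⟩
  refine (h.biUnion fun p _ => (hsub p.1.toList).prod (hsub p.2.toList)).subset ?_
  rintro _ ⟨p, hp, P, rfl⟩
  exact Set.mem_biUnion hp ⟨⟨_, List.filter_sublist, rfl⟩, ⟨_, List.filter_sublist, rfl⟩⟩

theorem map_shiftAppend_filter {M : Type*} [Monoid M] (g : SWord →ₙ* M) (P : ℕ → Bool)
    (u : Word) :
    g (shiftAppend (u.toList.filter P)) =
      FreeMonoid.lift (fun n => if P n then g (FreeSemigroup.of (n + 1)) else 1) u *
        g (FreeSemigroup.of 0) := by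
  induction u using FreeMonoid.inductionOn' with
  | one => simp [shiftAppend]
  | of_mul n u ih =>
    by_cases h : P n
    · simpa [h, shiftAppend, mul_assoc] using congrArg (g (FreeSemigroup.of (n + 1)) * ·) ih
    · simpa [h] using ih

theorem sSatisfies_of_mem_deletionIdentities {M : Type*} [Monoid M] {Sig : Set (Word × Word)}
    (h : ∀ p ∈ Sig, Satisfies M p.1 p.2) :
    ∀ q ∈ deletionIdentities Sig, SSatisfies M q.1 q.2 := by
  rintro _ ⟨p, hp, P, rfl⟩ g
  simp only [map_shiftAppend_filter, h p hp _]

/-- Left multiplication by an element, as a self-map of a semigroup. -/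
def leftMul {S : Type*} [Semigroup S] (s : S) : Function.End S := fun y => s * y

theorem leftMul_mul {S : Type*} [Semigroup S] (a b : S) :
    leftMul (a * b) = leftMul a * leftMul b :=
  funext fun y => mul_assoc a b y

/-- The monoid of self-maps of a semigroup generated by left multiplications by elements of `X`. -/
def leftMulMonoid {S : Type*} [Semigroup S] (X : Set S) : Submonoid (Function.End S) :=
  Submonoid.closure (leftMul '' X)

theorem monoidFG_leftMulMonoid {S : Type*} [Semigroup S] {X : Set S} (hX : X.Finite) :
    MonoidFG (leftMulMonoid X) :=
  ⟨_, (hX.image leftMul).preimage Subtype.val_injective.injOn,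
    Submonoid.closure_closure_coe_preimage⟩

theorem eq_one_or_eq_leftMul {S : Type*} [Semigroup S] {X : Set S} {t : Function.End S}
    (ht : t ∈ leftMulMonoid X) : t = 1 ∨ ∃ s, t = leftMul s := by
  induction ht using Submonoid.closure_induction with
  | mem t ht =>
    obtain ⟨s, -, rfl⟩ := ht
    exact .inr ⟨s, rfl⟩
  | one => exact .inl rfl
  | mul a b _ _ iha ihb =>
    rcases iha with rfl | ⟨s, rfl⟩
    · simpa using ihb
    · rcases ihb with rfl | ⟨r, rfl⟩
      · exact .inr ⟨s, mul_one _⟩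
      · exact .inr ⟨s * r, (leftMul_mul s r).symm⟩

theorem leftMul_mem_leftMulMonoid {S : Type*} [Semigroup S] {X : Set S}
    (hX : Subsemigroup.closure X = ⊤) (s : S) : leftMul s ∈ leftMulMonoid X := by
  have hs : s ∈ Subsemigroup.closure X := hX ▸ Subsemigroup.mem_top s
  induction hs using Subsemigroup.closure_induction with
  | mem x hx => exact Submonoid.subset_closure ⟨x, hx, rfl⟩
  | mul a b _ _ iha ihb => exact leftMul_mul a b ▸ mul_mem iha ihb

theorem finite_of_finite_leftMulMonoid {S : Type*} [Semigroup S] {X : Set S} (hfin : X.Finite)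
    (hX : Subsemigroup.closure X = ⊤) [Finite (leftMulMonoid X)] : Finite S := by
  have himage : (Set.image2 (fun (t : Function.End S) x => t x) (leftMulMonoid X) X).Finite :=
    (Set.toFinite (leftMulMonoid X : Set (Function.End S))).image2 _ hfin
  refine Set.finite_univ_iff.1 (himage.subset fun s _ => ?_)
  have hs : s ∈ Subsemigroup.closure X := hX ▸ Subsemigroup.mem_top s
  induction hs using Subsemigroup.closure_induction with
  | mem x hx => exact ⟨1, one_mem _, x, hx, rfl⟩
  | mul a b _ _ _ ihb =>
    obtain ⟨t, ht, x, hx, rfl⟩ := ihb trivial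
    exact ⟨leftMul a * t, mul_mem (leftMul_mem_leftMulMonoid hX a) ht, x, hx, rfl⟩

theorem satisfies_leftMulMonoid {S : Type*} [Semigroup S] (X : Set S) {Sig : Set (Word × Word)}
    (h : ∀ q ∈ deletionIdentities Sig, SSatisfies S q.1 q.2) :
    ∀ p ∈ Sig, Satisfies (leftMulMonoid X) p.1 p.2 := by
  classical
  intro p hp f
  refine Subtype.ext (funext fun y => ?_)
  have hs (n : ℕ) : ∃ s, f (FreeMonoid.of n) ≠ 1 →
      (f (FreeMonoid.of n) : Function.End S) = leftMul s := by
    rcases eq_one_or_eq_leftMul (f (FreeMonoid.of n)).2 with h1 | ⟨s, hs⟩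
    · exact ⟨y, fun hne => absurd (Subtype.ext h1) hne⟩
    · exact ⟨s, fun _ => hs⟩
  choose s hs using hs
  let g : SWord →ₙ* S := FreeSemigroup.lift fun n => Nat.casesOn n y s
  let P : ℕ → Bool := fun n => decide (f (FreeMonoid.of n) ≠ 1)
  have key (u : Word) : (f u : Function.End S) y = g (shiftAppend (u.toList.filter P)) := by
    induction u using FreeMonoid.inductionOn' with
    | one => simp [shiftAppend, g, Function.End.one_def]
    | of_mul n u ih =>
      have hmul : (f (FreeMonoid.of n * u) : Function.End S) y =
          (f (FreeMonoid.of n) : Function.End S) ((f u : Function.End S) y) := by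
        rw [map_mul]
        rfl
      rw [hmul, ih]
      by_cases hn : f (FreeMonoid.of n) = 1
      · simp [P, hn, Function.End.one_def]
      · rw [hs n hn]
        simp [P, hn, shiftAppend, leftMul, g]
  rw [key, key]
  exact h _ ⟨p, hp, P, rfl⟩ g

/-- A finite monoid `M` belongs to a finitely based locally finite semigroup
variety iff it belongs to a finitely based locally finite monoid variety. -/
theorem statement6 (M : Type) [Monoid M] [Finite M] :
    (∃ Sig : Set (SWord × SWord), Sig.Finite ∧
        (∀ p ∈ Sig, SSatisfies M p.1 p.2) ∧
        (∀ (S : Type) [Semigroup S], SemigroupFG S →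
          (∀ p ∈ Sig, SSatisfies S p.1 p.2) → Finite S)) ↔
    (∃ Sig : Set (Word × Word), Sig.Finite ∧
        (∀ p ∈ Sig, Satisfies M p.1 p.2) ∧
        (∀ (N : Type) [Monoid N], MonoidFG N →
          (∀ p ∈ Sig, Satisfies N p.1 p.2) → Finite N)) := by
  constructor
  · rintro ⟨Sig, hfin, hM, hlf⟩
    refine ⟨(fun p => (toWord p.1, toWord p.2)) '' Sig, hfin.image _, ?_, fun N _ hN hsat => ?_⟩
    · rintro _ ⟨p, hp, rfl⟩
      exact (satisfies_toWord_iff _ _).2 (hM p hp)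
    · exact hlf N hN.semigroupFG fun p hp =>
        (satisfies_toWord_iff _ _).1 (hsat _ (Set.mem_image_of_mem _ hp))
  · rintro ⟨Sig, hfin, hM, hlf⟩
    refine ⟨deletionIdentities Sig, deletionIdentities_finite hfin,
      sSatisfies_of_mem_deletionIdentities hM, ?_⟩
    rintro S _ ⟨X, hXfin, hX⟩ hsat
    have := hlf (leftMulMonoid X) (monoidFG_leftMulMonoid hXfin) (satisfies_leftMulMonoid X hsat)
    exact finite_of_finite_leftMulMonoid hXfin hX
end
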